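/- arXiv:2305.12470 — 12 statements merged into one kernel-verified Lean document; each statement's English description precedes it below -/
import Mathlib

section
/- Let 0 < p and let Δ be a real offset with p ≤ Δ ≤ 1 − p. Then the Lebesgue measure of the set {t ∈ [0,1) : t < p and fract(t + Δ) < p} equals 0. (Two walkers whose TRVs are offset by any Δ ∈ [p, 1−p] can never terminate at the same timestep.) -/
open MeasureTheory

/-- Two walkers whose TRVs are offset by any `Δ ∈ [p, 1−p]` can never terminate
at the same timestep: the set where both `t < p` and `fract (t + Δ) < p` is null. -/
theorem stmt3 (p Δ : ℝ) (hp : 0 < p) (hΔ₁ : p ≤ Δ) (hΔ₂ : Δ ≤ 1 - p) :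
    volume {t : ℝ | t ∈ Set.Ico (0 : ℝ) 1 ∧ t < p ∧ Int.fract (t + Δ) < p} = 0 := by
  have h : {t : ℝ | t ∈ Set.Ico (0 : ℝ) 1 ∧ t < p ∧ Int.fract (t + Δ) < p} = ∅ := by
    apply Set.eq_empty_of_forall_notMem
    rintro t ⟨⟨h0, _⟩, htp, hf⟩
    have hfr : Int.fract (t + Δ) = t + Δ :=
      Int.fract_eq_self.mpr ⟨by linarith, by linarith⟩
    rw [hfr] at hf
    linarith
  rw [h]
  exact measure_empty
end

section
/- Let 0 ≤ Δ ≤ p ≤ 1/2. Then the Lebesgue measure of the set {t ∈ [0,1) : t < p and fract(t + Δ) < p} equals p − Δ. (Two walkers whose TRVs are offset by Δ < p terminate simultaneously with probability p − Δ; conditioned on the first terminating, the second terminates with probability (p−Δ)/p.) -/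
open MeasureTheory

/-- Two walkers whose TRVs are offset by `Δ ≤ p` terminate simultaneously with
probability `p − Δ`. -/
theorem stmt4 (p Δ : ℝ) (hΔ : 0 ≤ Δ) (hΔp : Δ ≤ p) (hp : p ≤ 1 / 2) :
    volume {t : ℝ | t ∈ Set.Ico (0 : ℝ) 1 ∧ t < p ∧ Int.fract (t + Δ) < p} =
      ENNReal.ofReal (p - Δ) := by
  have h : {t : ℝ | t ∈ Set.Ico (0 : ℝ) 1 ∧ t < p ∧ Int.fract (t + Δ) < p} =
      Set.Ico 0 (p - Δ) := by
    ext t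
    simp only [Set.mem_setOf_eq, Set.mem_Ico]
    constructor
    · rintro ⟨⟨h0, _⟩, h2, h3⟩
      rw [Int.fract_eq_self.mpr ⟨by linarith, by linarith⟩] at h3
      exact ⟨h0, by linarith⟩
    · rintro ⟨h0, h1⟩
      refine ⟨⟨h0, by linarith⟩, by linarith, ?_⟩
      rw [Int.fract_eq_self.mpr ⟨by linarith, by linarith⟩]
      linarith
  rw [h, Real.volume_Ico, sub_zero]
end

section
/- Let 0 < p < 1 and let n = ⌊1/p⌋. For all natural numbers k < l < n, the Lebesgue measure of the set {t ∈ [0,1) : fract(t + k·p) < p and fract(t + l·p) < p} equals 0. (Hence up to ⌊1/p⌋ random walkers, with TRVs fract(t + k·p) for k = 0, …, ⌊1/p⌋ − 1, can be conditioned so that no two of them ever terminate at the same timestep — the maximum size of a mutually antithetic ensemble.) -/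
open MeasureTheory

/-- Maximum size of an antithetic ensemble: for walkers with TRVs
`fract (t + k·p)`, `k = 0, …, ⌊1/p⌋ − 1`, no two of them ever terminate at the
same timestep. -/
theorem stmt5 (p : ℝ) (hp : 0 < p) (hp1 : p < 1) (k l : ℕ)
    (hkl : k < l) (hl : l < Nat.floor (1 / p)) :
    volume {t : ℝ | t ∈ Set.Ico (0 : ℝ) 1 ∧
        Int.fract (t + k * p) < p ∧ Int.fract (t + l * p) < p} = 0 := by
  have hE : {t : ℝ | t ∈ Set.Ico (0 : ℝ) 1 ∧
        Int.fract (t + k * p) < p ∧ Int.fract (t + l * p) < p} = ∅ := by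
    ext t
    simp only [Set.mem_setOf_eq, Set.mem_empty_iff_false, iff_false]
    rintro ⟨_, h1, h2⟩
    have hn : ((l + 1 : ℕ) : ℝ) ≤ 1 / p :=
      (Nat.le_floor_iff (by positivity)).1 hl
    rw [le_div_iff₀ hp] at hn
    push_cast at hn
    have hk : (k : ℝ) + 1 ≤ l := by exact_mod_cast hkl
    have hkp : ((k : ℝ) + 1) * p ≤ l * p := mul_le_mul_of_nonneg_right hk hp.le
    have hk0 : 0 ≤ (k : ℝ) * p := by positivity
    have a0 := Int.fract_nonneg (t + k * p)
    have b0 := Int.fract_nonneg (t + l * p)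
    have a1 := Int.floor_add_fract (t + k * p)
    have b1 := Int.floor_add_fract (t + l * p)
    have m0 : ((⌊t + k * p⌋ : ℤ) : ℝ) < (⌊t + l * p⌋ : ℤ) := by linarith
    have m1 : ((⌊t + l * p⌋ : ℤ) : ℝ) < (⌊t + k * p⌋ : ℤ) + 1 := by linarith
    have m0' : ⌊t + k * p⌋ < ⌊t + l * p⌋ := by exact_mod_cast m0
    have m1' : ⌊t + l * p⌋ < ⌊t + k * p⌋ + 1 := by exact_mod_cast m1
    omega
  rw [hE, measure_empty]
end

section
/- Let 0 < p ≤ 1/2 and r = (1−2p)/(1−p). For every m ∈ ℕ, the conditional expected length of a walk given that its antithetic partner has length m satisfies ∑_{j=0}^∞ j · q(j | m) = (1−2p)/p + 2·r^m. (In particular this exceeds the marginal mean (1−p)/p for small m and is below it for large m: antithetic walk lengths are negatively correlated.) -/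
/-- Conditional antithetic walk-length distribution (Eq. 13 of the paper):
`qCond p i j` is the probability that the second walk has length `j` given
that its antithetic partner has length `i`. -/
noncomputable def qCond (p : ℝ) (i j : ℕ) : ℝ :=
  if j < i then ((1 - 2 * p) / (1 - p)) ^ j * (p / (1 - p))
  else if j = i then 0
  else ((1 - 2 * p) / (1 - p)) ^ i * (1 - p) ^ (j - i - 1) * p

/-- The finite part of the sum. -/
theorem head_sum (p : ℝ) (hp : 0 < p) (hp2 : p ≤ 1 / 2) (m : ℕ) :
    ∑ j ∈ Finset.range m, (j : ℝ) * (((1 - 2 * p) / (1 - p)) ^ j * (p / (1 - p))) =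
      (1 - 2 * p) / p * (1 - ((1 - 2 * p) / (1 - p)) ^ m)
        - m * ((1 - 2 * p) / (1 - p)) ^ m := by
  have h1 : (1 - p) ≠ 0 := by linarith
  have h0 : p ≠ 0 := hp.ne'
  induction m with
  | zero => simp
  | succ k ih =>
    rw [Finset.sum_range_succ, ih, pow_succ]
    generalize ((1 - 2 * p) / (1 - p)) ^ k = x
    push_cast
    field_simp
    ring

/-- Conditional expected length of a walk given that its antithetic partner has
length `m`: `∑_{j=0}^∞ j · q(j | m) = (1−2p)/p + 2·((1−2p)/(1−p))^m`. -/
theorem stmt7 (p : ℝ) (hp : 0 < p) (hp2 : p ≤ 1 / 2) (m : ℕ) :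
    HasSum (fun j : ℕ => (j : ℝ) * qCond p m j)
      ((1 - 2 * p) / p + 2 * ((1 - 2 * p) / (1 - p)) ^ m) := by
  have h1 : (1 - p) ≠ 0 := by linarith
  have h0 : p ≠ 0 := hp.ne'
  have hn : ‖1 - p‖ < 1 := by
    rw [Real.norm_eq_abs, abs_lt]; constructor <;> linarith
  have hA := hasSum_coe_mul_geometric_of_norm_lt_one hn
  have hB := hasSum_geometric_of_norm_lt_one hn
  rw [← hasSum_nat_add_iff' (m + 1)]
  have hhead : ∑ j ∈ Finset.range (m + 1), (j : ℝ) * qCond p m j =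
      (1 - 2 * p) / p * (1 - ((1 - 2 * p) / (1 - p)) ^ m)
        - m * ((1 - 2 * p) / (1 - p)) ^ m := by
    rw [Finset.sum_range_succ, ← head_sum p hp hp2 m]
    have hz : qCond p m m = 0 := by simp [qCond]
    rw [hz, mul_zero, add_zero]
    refine Finset.sum_congr rfl fun j hj => ?_
    rw [qCond, if_pos (Finset.mem_range.mp hj)]
  rw [hhead]
  have hC := (hA.add (hB.mul_left ((m : ℝ) + 1))).mul_left
    (((1 - 2 * p) / (1 - p)) ^ m * p)
  convert hC using 1
  · rfl
  · funext n
    have e : n + (m + 1) - m - 1 = n := by omega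
    rw [qCond, if_neg (by omega), if_neg (by omega), e]
    push_cast
    ring
  · generalize ((1 - 2 * p) / (1 - p)) ^ m = x
    rw [sub_sub_cancel]
    field_simp
    ring
end

section
/- Let 0 < p ≤ 1/2 and r = (1−2p)/(1−p). For every j ∈ ℕ, ∑_{i=0}^∞ (1−p)^i · p · q(j | i) = (1−p)^j · p. (Antithetic termination preserves the marginal distribution of each walk's length, so the q-GRF estimator remains unbiased.) -/
/-- Antithetic termination preserves the marginal (geometric) distribution of
each walk's length: `∑_{i=0}^∞ (1−p)^i·p·q(j | i) = (1−p)^j·p`. -/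
theorem stmt8 (p : ℝ) (hp : 0 < p) (hp2 : p ≤ 1 / 2) (j : ℕ) :
    HasSum (fun i : ℕ => (1 - p) ^ i * p * qCond p i j) ((1 - p) ^ j * p) := by
  have hq : (1 - p) ≠ 0 := by linarith
  have hr : ∀ i : ℕ, (1 - p) ^ i * ((1 - 2 * p) / (1 - p)) ^ i = (1 - 2 * p) ^ i := by
    intro i
    rw [← mul_pow, mul_div_cancel₀ _ hq]
  rw [← hasSum_nat_add_iff' (j + 1)]
  have hfin : ∑ i ∈ Finset.range (j + 1), (1 - p) ^ i * p * qCond p i j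
      = p * ((1 - p) ^ j - (1 - 2 * p) ^ j) := by
    have h0 : qCond p j j = 0 := by simp [qCond]
    rw [Finset.sum_range_succ, h0, mul_zero, add_zero]
    have h1 : ∑ i ∈ Finset.range j, (1 - p) ^ i * p * qCond p i j
        = ∑ i ∈ Finset.range j, p ^ 2 * ((1 - 2 * p) ^ i * (1 - p) ^ (j - 1 - i)) := by
      refine Finset.sum_congr rfl fun i hi => ?_
      have hi' := Finset.mem_range.mp hi
      have e : j - i - 1 = j - 1 - i := by omega
      rw [qCond, if_neg (by omega), if_neg (by omega), e, ← hr i]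
      ring
    rw [h1, ← Finset.mul_sum]
    have h2 := (Commute.all (1 - 2 * p) (1 - p)).geom_sum₂_mul j
    linear_combination (-p) * h2
  have hg := (hasSum_geometric_of_lt_one (r := 1 - p) (by linarith) (by linarith)).mul_right
    (p ^ 2 * (1 - 2 * p) ^ j)
  rw [hfin]
  convert hg using 1
  · rfl
  · funext i
    rw [qCond, if_pos (by omega), ← hr j, pow_add, pow_succ]
    field_simp
  · rw [sub_sub_cancel]
    field_simp
    ring
end

section
/- Let 0 < p ≤ 1/2 and r = (1−2p)/(1−p). For all i, j ∈ ℕ, (1−p)^i · p · q(j | i) = (1−p)^j · p · q(i | j). (The joint distribution of the two lengths of an antithetic pair of walks is exchangeable.) -/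
theorem qCond_aux (p : ℝ) (hp : 1 - p ≠ 0) (j k : ℕ) :
    (1 - p) ^ (j + k + 1) * p * qCond p (j + k + 1) j
      = (1 - p) ^ j * p * qCond p j (j + k + 1) := by
  have h1 : j < j + k + 1 := by omega
  have h2 : ¬ (j + k + 1 < j) := by omega
  have h3 : ¬ (j + k + 1 = j) := by omega
  have h4 : j + k + 1 - j - 1 = k := by omega
  unfold qCond
  rw [if_pos h1, if_neg h2, if_neg h3, h4]
  generalize ((1 - 2 * p) / (1 - p)) ^ j = R
  rw [pow_succ, pow_add]
  field_simp

/-- The joint distribution of the two lengths of an antithetic pair of walks is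
exchangeable: `(1−p)^i·p·q(j | i) = (1−p)^j·p·q(i | j)` for all `i, j`. -/
theorem stmt9 (p : ℝ) (hp : 0 < p) (hp2 : p ≤ 1 / 2) (i j : ℕ) :
    (1 - p) ^ i * p * qCond p i j = (1 - p) ^ j * p * qCond p j i := by
  have h : 1 - p ≠ 0 := by
    have : 0 < 1 - p := by linarith
    exact this.ne'
  rcases lt_trichotomy i j with hij | hij | hij
  · obtain ⟨k, rfl⟩ := Nat.exists_eq_add_of_lt hij
    exact (qCond_aux p h i k).symm
  · rw [hij]
  · obtain ⟨k, rfl⟩ := Nat.exists_eq_add_of_lt hij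
    exact qCond_aux p h j k
end

section
/- Let 0 < p ≤ 1/2 and r = (1−2p)/(1−p). Then ∑_{i=0}^∞ ∑_{j=0}^∞ (i·j) · (1−p)^i · p · q(j | i) = ((1−p)/p)² − 1/(2p). (Since each marginal mean is (1−p)/p, the covariance of the lengths of an antithetic pair of walks equals −1/(2p), which is strictly negative.) -/
lemma finite_part (p : ℝ) (hp : 0 < p) (hp2 : p ≤ 1 / 2) (i : ℕ) :
    ∑ j ∈ Finset.range i, (j : ℝ) * (((1 - 2 * p) / (1 - p)) ^ j * (p / (1 - p))) =
      (1 - 2 * p) / p - ((1 - 2 * p) / (1 - p)) ^ i * ((1 - p) / p + i - 1) := by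
  have h1 : (1 - p) ≠ 0 := by linarith
  have h2 : p ≠ 0 := hp.ne'
  induction i with
  | zero => simp; field_simp; ring
  | succ n ih =>
    rw [Finset.sum_range_succ, ih, pow_succ]
    generalize ((1 - 2 * p) / (1 - p)) ^ n = x
    push_cast
    field_simp
    ring

lemma cond_mean (p : ℝ) (hp : 0 < p) (hp2 : p ≤ 1 / 2) (i : ℕ) :
    HasSum (fun j : ℕ => (j : ℝ) * qCond p i j)
      ((1 - 2 * p) / p + 2 * ((1 - 2 * p) / (1 - p)) ^ i) := by
  have h1 : (1 - p) ≠ 0 := by linarith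
  have h2 : p ≠ 0 := hp.ne'
  have hn : ‖1 - p‖ < 1 := by
    rw [Real.norm_eq_abs, abs_lt]; constructor <;> linarith
  rw [← hasSum_nat_add_iff' (i + 1)]
  have hfin : ∑ j ∈ Finset.range (i + 1), (j : ℝ) * qCond p i j =
      (1 - 2 * p) / p - ((1 - 2 * p) / (1 - p)) ^ i * ((1 - p) / p + i - 1) := by
    rw [Finset.sum_range_succ, ← finite_part p hp hp2 i]
    have h0 : qCond p i i = 0 := by simp [qCond]
    rw [h0, mul_zero, add_zero]
    refine Finset.sum_congr rfl fun j hj => ?_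
    rw [qCond, if_pos (Finset.mem_range.1 hj)]
  rw [hfin]
  have hA := hasSum_coe_mul_geometric_of_norm_lt_one hn
  have hB := hasSum_geometric_of_norm_lt_one hn
  have hC := (hA.add (hB.mul_left ((i : ℝ) + 1))).mul_left (((1 - 2 * p) / (1 - p)) ^ i * p)
  have hval : (((1 - 2 * p) / (1 - p)) ^ i * p) *
      ((1 - p) / (1 - (1 - p)) ^ 2 + ((i : ℝ) + 1) * (1 - (1 - p))⁻¹) =
      (1 - 2 * p) / p + 2 * ((1 - 2 * p) / (1 - p)) ^ i - ((1 - 2 * p) / p -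
        ((1 - 2 * p) / (1 - p)) ^ i * ((1 - p) / p + i - 1)) := by
    generalize ((1 - 2 * p) / (1 - p)) ^ i = x
    have e : 1 - (1 - p) = p := by ring
    rw [e]
    field_simp
    ring
  rw [hval] at hC
  have hf : (fun k : ℕ => ((k + (i + 1) : ℕ) : ℝ) * qCond p i (k + (i + 1))) = fun k : ℕ =>
      ((1 - 2 * p) / (1 - p)) ^ i * p * ((k : ℝ) * (1 - p) ^ k + ((i : ℝ) + 1) * (1 - p) ^ k) := by
    funext k
    show ((k + (i + 1) : ℕ) : ℝ) * qCond p i (k + (i + 1)) = _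
    have e1 : ¬ (k + (i + 1) < i) := by omega
    have e2 : ¬ (k + (i + 1) = i) := by omega
    have e3 : k + (i + 1) - i - 1 = k := by omega
    rw [qCond, if_neg e1, if_neg e2, e3]
    push_cast
    ring
  rw [hf]
  exact hC

/-- Second mixed moment of the lengths of an antithetic pair of walks:
`∑_{i}∑_{j} i·j·(1−p)^i·p·q(j | i) = ((1−p)/p)² − 1/(2p)`, so the covariance
of the two lengths equals `−1/(2p) < 0`. -/
theorem stmt10 (p : ℝ) (hp : 0 < p) (hp2 : p ≤ 1 / 2) :
    ∑' i : ℕ, ∑' j : ℕ, ((i : ℝ) * (j : ℝ)) * ((1 - p) ^ i * p * qCond p i j) =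
      ((1 - p) / p) ^ 2 - 1 / (2 * p) := by
  have h1 : (1 - p) ≠ 0 := by linarith
  have h2 : p ≠ 0 := hp.ne'
  have hn : ‖1 - p‖ < 1 := by
    rw [Real.norm_eq_abs, abs_lt]; constructor <;> linarith
  have hn2 : ‖1 - 2 * p‖ < 1 := by
    rw [Real.norm_eq_abs, abs_lt]; constructor <;> linarith
  have hin : ∀ i : ℕ, ∑' j : ℕ, ((i : ℝ) * (j : ℝ)) * ((1 - p) ^ i * p * qCond p i j) =
      (1 - 2 * p) * ((i : ℝ) * (1 - p) ^ i) + 2 * p * ((i : ℝ) * (1 - 2 * p) ^ i) := by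
    intro i
    have h := ((cond_mean p hp hp2 i).mul_left ((i : ℝ) * (1 - p) ^ i * p)).tsum_eq
    have e : (1 - 2 * p) ^ i = (1 - p) ^ i * ((1 - 2 * p) / (1 - p)) ^ i := by
      rw [← mul_pow, mul_div_cancel₀ _ h1]
    rw [e]
    trans
    · refine Eq.trans (tsum_congr fun j => ?_) h
      ring
    · generalize ((1 - 2 * p) / (1 - p)) ^ i = x
      field_simp
  simp_rw [hin]
  rw [(((hasSum_coe_mul_geometric_of_norm_lt_one hn).mul_left (1 - 2 * p)).add
    ((hasSum_coe_mul_geometric_of_norm_lt_one hn2).mul_left (2 * p))).tsum_eq]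
  have e : 1 - (1 - p) = p := by ring
  have e' : 1 - (1 - 2 * p) = 2 * p := by ring
  rw [e, e']
  field_simp
  ring
end

section
/- Let 0 < p ≤ 1/2 and r = (1−2p)/(1−p). For all natural numbers n ≤ m, ∑_{i=m}^∞ ∑_{j=n}^∞ (1−p)^i · p · q(j | i) = r^n · (1−p)^m. (This is the joint probability that two antithetic walks contain prescribed subwalks of lengths m and n respectively; for n = m it equals (1−2p)^m, reproducing the joint subwalk probabilities of Eq. 20 of the paper.) -/
theorem qCond_hasSum (p : ℝ) (hp : 0 < p) (hp2 : p ≤ 1 / 2) (n d : ℕ) :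
    HasSum (fun j : ℕ => qCond p (n + d) (n + j)) (((1 - 2 * p) / (1 - p)) ^ n) := by
  have h1 : (1 - p) ≠ 0 := by linarith
  have hr : p / (1 - p) = 1 - (1 - 2 * p) / (1 - p) := by field_simp; ring
  have hg : HasSum (fun j : ℕ => (1 - p) ^ j) p⁻¹ := by
    have := hasSum_geometric_of_lt_one (r := 1 - p) (by linarith) (by linarith)
    simpa using this
  have htail : HasSum (fun j : ℕ => qCond p (n + d) (n + (j + (d + 1))))
      (((1 - 2 * p) / (1 - p)) ^ (n + d)) := by
    have h2 := hg.mul_left (((1 - 2 * p) / (1 - p)) ^ (n + d) * p)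
    rw [mul_assoc, mul_inv_cancel₀ hp.ne', mul_one] at h2
    refine h2.congr_fun ?_
    intro j
    have e : n + (j + (d + 1)) - (n + d) - 1 = j := by omega
    rw [qCond, if_neg (by omega), if_neg (by omega), e]
    ring
  have hfin : ∑ j ∈ Finset.range (d + 1), qCond p (n + d) (n + j) =
      ((1 - 2 * p) / (1 - p)) ^ n - ((1 - 2 * p) / (1 - p)) ^ (n + d) := by
    have h3 : ∑ j ∈ Finset.range d, qCond p (n + d) (n + j) =
        ∑ j ∈ Finset.range d, (((1 - 2 * p) / (1 - p)) ^ (n + j) -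
          ((1 - 2 * p) / (1 - p)) ^ (n + (j + 1))) := by
      refine Finset.sum_congr rfl fun j hj => ?_
      have := Finset.mem_range.1 hj
      rw [qCond, if_pos (by omega), hr]
      ring
    rw [Finset.sum_range_succ, h3,
      Finset.sum_range_sub' (fun j => ((1 - 2 * p) / (1 - p)) ^ (n + j))]
    simp [qCond]
  have h4 := (hasSum_nat_add_iff (f := fun j : ℕ => qCond p (n + d) (n + j)) (d + 1)).1 htail
  rw [hfin] at h4
  simpa using h4

/-- Joint probability that two antithetic walks contain prescribed subwalks of
lengths `m` and `n ≤ m` respectively: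
`∑_{i=m}^∞ ∑_{j=n}^∞ (1−p)^i·p·q(j | i) = ((1−2p)/(1−p))^n·(1−p)^m`. -/
theorem stmt11 (p : ℝ) (hp : 0 < p) (hp2 : p ≤ 1 / 2) (n m : ℕ) (hnm : n ≤ m) :
    ∑' i : ℕ, ∑' j : ℕ, (1 - p) ^ (m + i) * p * qCond p (m + i) (n + j) =
      ((1 - 2 * p) / (1 - p)) ^ n * (1 - p) ^ m := by
  have hg : HasSum (fun j : ℕ => (1 - p) ^ j) p⁻¹ := by
    have := hasSum_geometric_of_lt_one (r := 1 - p) (by linarith) (by linarith)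
    simpa using this
  have key : ∀ i : ℕ, ∑' j : ℕ, (1 - p) ^ (m + i) * p * qCond p (m + i) (n + j) =
      ((1 - 2 * p) / (1 - p)) ^ n * (1 - p) ^ m * p * (1 - p) ^ i := by
    intro i
    obtain ⟨d, hd⟩ := Nat.exists_eq_add_of_le (hnm.trans (Nat.le_add_right m i))
    have := ((qCond_hasSum p hp hp2 n d).mul_left ((1 - p) ^ (m + i) * p)).tsum_eq
    rw [← hd] at this
    rw [this]
    ring
  simp_rw [key]
  rw [(hg.mul_left _).tsum_eq, mul_assoc, mul_inv_cancel₀ hp.ne', mul_one]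
end

section
/- Let 0 < p ≤ 1/2, c = (1−2p)/(1−p)², and let a, b ∈ ℝ with |a| < 1 and |b| < 1. Set C = (a/(1−a))·(b/(1−b)) and D = C · c·(1−ab)/(1−c·ab). Then 1 − c·ab > 0 and C·D − C² = −(ab/((1−a)(1−b)))² · (p/(1−p))² · 1/(1−c·ab). (Closed form, Eq. 30 of the paper, for the entries of the matrix E that controls the variance change when one of two pairs of walkers is made antithetic.) -/
/-- Closed form (Eq. 30 of the paper) for the entries of the matrix `E` that
controls the variance change when one of two pairs of walkers is made
antithetic. -/
theorem stmt12 (p : ℝ) (hp : 0 < p) (hp2 : p ≤ 1 / 2) (a b : ℝ)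
    (ha : |a| < 1) (hb : |b| < 1) :
    let c := (1 - 2 * p) / (1 - p) ^ 2
    let C := (a / (1 - a)) * (b / (1 - b))
    let D := C * (c * (1 - a * b) / (1 - c * (a * b)))
    0 < 1 - c * (a * b) ∧
      C * D - C ^ 2 =
        -((a * b / ((1 - a) * (1 - b))) ^ 2) * (p / (1 - p)) ^ 2 *
          (1 / (1 - c * (a * b))) := by
  intro c C D
  have h1p : 0 < 1 - p := by linarith
  have hc1 : 1 - c = (p / (1 - p)) ^ 2 := by
    simp only [c]
    field_simp
    ring
  have hc0 : 0 ≤ c := div_nonneg (by linarith) (by positivity)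
  have hcle : c ≤ 1 := by nlinarith [sq_nonneg (p / (1 - p))]
  have hab : a * b < 1 := by
    have h : |a * b| < 1 := by
      rw [abs_mul]
      nlinarith [abs_nonneg a, abs_nonneg b]
    exact (abs_lt.mp h).2
  have hpos : 0 < 1 - c * (a * b) := by
    rcases le_total 0 (a * b) with h | h
    · nlinarith
    · nlinarith
  refine ⟨hpos, ?_⟩
  have hC : a * b / ((1 - a) * (1 - b)) = C := by
    simp only [C]
    rw [div_mul_div_comm]
  rw [hC, ← hc1]
  simp only [D]
  clear_value C c
  clear hC D
  generalize a * b = t at *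
  have hne := hpos.ne'
  field_simp
  ring
end

section
/- Let 0 < p ≤ 1/2, c = (1−2p)/(1−p)², ι a finite index set, and λ̄ : ι → ℝ with |λ̄_k| < 1 for all k. Define C_{pq} = (λ̄_p/(1−λ̄_p))·(λ̄_q/(1−λ̄_q)) and D_{pq} = C_{pq} · c·(1−λ̄_p λ̄_q)/(1−c·λ̄_p λ̄_q). Then for every y : ι → ℝ, ∑_{p,q ∈ ι} (C_{pq}·D_{pq} − C_{pq}²) · y_p · y_q = −(p/(1−p))² · ∑_{m=0}^∞ ( ∑_{k ∈ ι} (λ̄_k²/(1−λ̄_k)²) · ( (√(1−2p)/(1−p)) · λ̄_k )^m · y_k )², where the series over m converges. (Sum-of-squares decomposition, Eq. 36 of the paper.) -/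
/-- Sum-of-squares decomposition (Eq. 36 of the paper) of the quadratic form of
the matrix `E_{pq} = C_{pq}·D_{pq} − C_{pq}²`. -/
theorem stmt13 (ι : Type*) [Fintype ι] (p : ℝ) (hp : 0 < p) (hp2 : p ≤ 1 / 2)
    (lam : ι → ℝ) (hlam : ∀ k, |lam k| < 1) (y : ι → ℝ) :
    let c := (1 - 2 * p) / (1 - p) ^ 2
    let C : ι → ι → ℝ := fun k l => (lam k / (1 - lam k)) * (lam l / (1 - lam l))
    let D : ι → ι → ℝ := fun k l =>
      C k l * (c * (1 - lam k * lam l) / (1 - c * (lam k * lam l)))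
    ∃ S : ℝ,
      HasSum
        (fun m : ℕ =>
          (∑ k, lam k ^ 2 / (1 - lam k) ^ 2 *
              (Real.sqrt (1 - 2 * p) / (1 - p) * lam k) ^ m * y k) ^ 2) S ∧
      ∑ k, ∑ l, (C k l * D k l - C k l ^ 2) * y k * y l =
        -(p / (1 - p)) ^ 2 * S := by
  intro c C D
  have h1p : (0:ℝ) < 1 - p := by linarith
  have hc0 : 0 ≤ c := div_nonneg (by linarith) (by positivity)
  have hc : 1 - c = (p / (1 - p)) ^ 2 := by
    simp only [c]
    field_simp
    ring
  have hc1 : c ≤ 1 := by nlinarith [sq_nonneg (p / (1 - p))]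
  have hs : (Real.sqrt (1 - 2 * p) / (1 - p)) ^ 2 = c := by
    rw [div_pow, Real.sq_sqrt (by linarith)]
  have hx : ∀ k l, |c * (lam k * lam l)| < 1 := by
    intro k l
    rw [abs_mul, abs_mul, abs_of_nonneg hc0]
    have h1 : |lam k| * |lam l| < 1 :=
      mul_lt_one_of_nonneg_of_lt_one_left (abs_nonneg _) (hlam k) (hlam l).le
    have h2 : 0 ≤ |lam k| * |lam l| := by positivity
    nlinarith
  refine ⟨∑ k, ∑ l, (lam k ^ 2 / (1 - lam k) ^ 2 * y k) * (lam l ^ 2 / (1 - lam l) ^ 2 * y l) *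
    (1 - c * (lam k * lam l))⁻¹, ?_, ?_⟩
  · have key : HasSum (fun m : ℕ => ∑ k, ∑ l,
        (lam k ^ 2 / (1 - lam k) ^ 2 * y k) * (lam l ^ 2 / (1 - lam l) ^ 2 * y l) *
        (c * (lam k * lam l)) ^ m) _ :=
      hasSum_sum (fun k _ => hasSum_sum (fun l _ =>
        (hasSum_geometric_of_abs_lt_one (hx k l)).mul_left _))
    convert key using 2 with m
    rw [sq, Finset.sum_mul_sum]
    refine Finset.sum_congr rfl fun k _ => Finset.sum_congr rfl fun l _ => ?_
    rw [← hs]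
    ring
  · rw [Finset.mul_sum]
    refine Finset.sum_congr rfl fun k _ => ?_
    rw [Finset.mul_sum]
    refine Finset.sum_congr rfl fun l _ => ?_
    rw [← hc]
    have hne : 1 - c * (lam k * lam l) ≠ 0 := by
      have := (abs_lt.mp (hx k l)).2
      linarith
    have hr : c * (1 - lam k * lam l) / (1 - c * (lam k * lam l)) =
        1 - (1 - c) * (1 - c * (lam k * lam l))⁻¹ := by
      clear_value c
      generalize lam k * lam l = x at hne ⊢
      field_simp
      ring
    simp only [D, C]
    rw [hr, ← div_pow, ← div_pow]
    clear_value c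
    ring
end

section
/- Let 0 < p ≤ 1/2, c = (1−2p)/(1−p)², ι a finite index set, and λ̄ : ι → ℝ with |λ̄_k| < 1 for all k. Define C_{pq} = (λ̄_p/(1−λ̄_p))·(λ̄_q/(1−λ̄_q)) and D_{pq} = C_{pq} · c·(1−λ̄_p λ̄_q)/(1−c·λ̄_p λ̄_q). Then the matrix E with entries E_{pq} = C_{pq}·D_{pq} − C_{pq}² is negative semidefinite: for every y : ι → ℝ, ∑_{p,q ∈ ι} E_{pq} · y_p · y_q ≤ 0. (Core of Theorem 3.1: making one of two pairs of walkers antithetic never increases the corresponding variance contribution, for any graph and any 0 < p ≤ 1/2.) -/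
theorem geom_kernel_nonneg {ι : Type*} [Fintype ι] (c : ℝ) (hc0 : 0 ≤ c) (hc1 : c < 1)
    (lam : ι → ℝ) (hlam : ∀ k, |lam k| < 1) (a : ι → ℝ) :
    0 ≤ ∑ k, ∑ l, a k * a l * (1 - c * (lam k * lam l))⁻¹ := by
  have h : HasSum (fun n : ℕ => ∑ k, ∑ l, a k * a l * (c * (lam k * lam l)) ^ n)
      (∑ k, ∑ l, a k * a l * (1 - c * (lam k * lam l))⁻¹) := by
    refine hasSum_sum fun k _ => hasSum_sum fun l _ => HasSum.mul_left _ ?_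
    apply hasSum_geometric_of_abs_lt_one
    rw [abs_mul, abs_mul, abs_of_nonneg hc0]
    have h1 : |lam k| * |lam l| ≤ 1 :=
      mul_le_one₀ (hlam k).le (abs_nonneg _) (hlam l).le
    calc c * (|lam k| * |lam l|) ≤ c * 1 := mul_le_mul_of_nonneg_left h1 hc0
      _ < 1 := by linarith
  refine h.nonneg fun n => ?_
  have e : ∑ k, ∑ l, a k * a l * (c * (lam k * lam l)) ^ n
      = c ^ n * ((∑ k, a k * lam k ^ n) * (∑ l, a l * lam l ^ n)) := by
    rw [Finset.sum_mul_sum, Finset.mul_sum]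
    refine Finset.sum_congr rfl fun k _ => ?_
    rw [Finset.mul_sum]
    refine Finset.sum_congr rfl fun l _ => ?_
    rw [mul_pow, mul_pow]; ring
  show 0 ≤ ∑ k, ∑ l, a k * a l * (c * (lam k * lam l)) ^ n
  rw [e]
  exact mul_nonneg (pow_nonneg hc0 n) (mul_self_nonneg _)

/-- Core of Theorem 3.1: the matrix `E_{pq} = C_{pq}·D_{pq} − C_{pq}²` is
negative semidefinite, so making one of two pairs of walkers antithetic never
increases the corresponding variance contribution, for any graph and any
`0 < p ≤ 1/2`. -/
theorem stmt14 (ι : Type*) [Fintype ι] (p : ℝ) (hp : 0 < p) (hp2 : p ≤ 1 / 2)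
    (lam : ι → ℝ) (hlam : ∀ k, |lam k| < 1) :
    let c := (1 - 2 * p) / (1 - p) ^ 2
    let C : ι → ι → ℝ := fun k l => (lam k / (1 - lam k)) * (lam l / (1 - lam l))
    let D : ι → ι → ℝ := fun k l =>
      C k l * (c * (1 - lam k * lam l) / (1 - c * (lam k * lam l)))
    ∀ y : ι → ℝ,
      ∑ k, ∑ l, (C k l * D k l - C k l ^ 2) * y k * y l ≤ 0 := by
  intro c C D y
  have hq : 0 < (1 - p) ^ 2 := by have : 0 < 1 - p := by linarith
                                  positivity
  have hc0 : 0 ≤ c := div_nonneg (by linarith) hq.le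
  have hc1 : c < 1 := by
    show (1 - 2 * p) / (1 - p) ^ 2 < 1
    rw [div_lt_one hq]; nlinarith
  have key := geom_kernel_nonneg c hc0 hc1 lam hlam
    (fun k => (lam k / (1 - lam k)) ^ 2 * y k)
  have e : ∑ k, ∑ l, (C k l * D k l - C k l ^ 2) * y k * y l
      = -(1 - c) * ∑ k, ∑ l, ((lam k / (1 - lam k)) ^ 2 * y k) *
        ((lam l / (1 - lam l)) ^ 2 * y l) * (1 - c * (lam k * lam l))⁻¹ := by
    rw [Finset.mul_sum]
    refine Finset.sum_congr rfl fun k _ => ?_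
    rw [Finset.mul_sum]
    refine Finset.sum_congr rfl fun l _ => ?_
    have h1 : |lam k * lam l| ≤ 1 := by
      rw [abs_mul]
      exact mul_le_one₀ (hlam k).le (abs_nonneg _) (hlam l).le
    have h2 : 1 - c * (lam k * lam l) ≠ 0 := by
      have := mul_le_mul_of_nonneg_left ((le_abs_self _).trans h1) hc0
      linarith
    have h3 : c * (1 - lam k * lam l) / (1 - c * (lam k * lam l))
        = 1 - (1 - c) * (1 - c * (lam k * lam l))⁻¹ := by
      rw [div_eq_mul_inv]
      linear_combination mul_inv_cancel₀ h2
    simp only [D, C]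
    rw [h3]
    ring
  rw [e]
  exact mul_nonpos_of_nonpos_of_nonneg (by linarith) key
end

section
/- Let 0 < p < 1 and let Δ ∈ ℝ satisfy p(1−p) ≤ Δ ≤ 1−p; set c_Δ = (1−p−Δ)/(1−p)², so that 0 ≤ c_Δ ≤ 1. Let ι be a finite index set and λ̄ : ι → ℝ with |λ̄_k| < 1 for all k. Define C_{pq} = (λ̄_p/(1−λ̄_p))·(λ̄_q/(1−λ̄_q)) and D^Δ_{pq} = (λ̄_pλ̄_q·c_Δ/(1−λ̄_pλ̄_q·c_Δ)) · ((1−λ̄_pλ̄_q)/((1−λ̄_p)(1−λ̄_q))). Then the matrix with entries C_{pq}·(D^Δ_{pq} − C_{pq}) is negative semidefinite: for every y : ι → ℝ, ∑_{p,q ∈ ι} C_{pq}·(D^Δ_{pq} − C_{pq})·y_p·y_q ≤ 0. (Core of Theorem 3.2: walkers whose TRVs are offset by any Δ with p(1−p) ≤ Δ ≤ 1−p yield variance contributions no larger than independent walkers.) -/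
theorem aux_psd {ι : Type*} [Fintype ι] (c : ℝ) (hc : 0 ≤ c) (hc1 : c ≤ 1)
    (a z : ι → ℝ) (ha : ∀ k, |a k| < 1) :
    0 ≤ ∑ k, ∑ l, (1 - a k * a l * c)⁻¹ * (z k * z l) := by
  have hs : HasSum (fun n : ℕ => ∑ k, ∑ l, (a k * a l * c) ^ n * (z k * z l))
      (∑ k, ∑ l, (1 - a k * a l * c)⁻¹ * (z k * z l)) := by
    refine hasSum_sum fun k _ => hasSum_sum fun l _ => ?_
    refine (hasSum_geometric_of_abs_lt_one ?_).mul_right _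
    rw [abs_mul, abs_mul, abs_of_nonneg hc]
    have h1 : |a k| * |a l| < 1 :=
      mul_lt_one_of_nonneg_of_lt_one_left (abs_nonneg _) (ha k) (ha l).le
    exact lt_of_le_of_lt
      (mul_le_of_le_one_right (mul_nonneg (abs_nonneg _) (abs_nonneg _)) hc1) h1
  refine hs.nonneg fun n => ?_
  have : ∑ k, ∑ l, (a k * a l * c) ^ n * (z k * z l)
      = c ^ n * ((∑ k, a k ^ n * z k) * (∑ l, a l ^ n * z l)) := by
    rw [Finset.sum_mul_sum, Finset.mul_sum]
    refine Finset.sum_congr rfl fun k _ => ?_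
    rw [Finset.mul_sum]
    refine Finset.sum_congr rfl fun l _ => ?_
    rw [mul_pow, mul_pow]; ring
  rw [this]
  exact mul_nonneg (pow_nonneg hc n) (mul_self_nonneg _)

/-- Core of Theorem 3.2: walkers whose TRVs are offset by any `Δ` with
`p(1−p) ≤ Δ ≤ 1−p` yield variance contributions no larger than independent
walkers: the matrix with entries `C_{pq}·(D^Δ_{pq} − C_{pq})` is negative
semidefinite. -/
theorem stmt19 (p Δ : ℝ) (hp : 0 < p) (hp1 : p < 1)
    (hΔ₁ : p * (1 - p) ≤ Δ) (hΔ₂ : Δ ≤ 1 - p)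
    (ι : Type*) [Fintype ι] (lam : ι → ℝ) (hlam : ∀ k, |lam k| < 1) :
    let cΔ := (1 - p - Δ) / (1 - p) ^ 2
    let C : ι → ι → ℝ := fun k l => (lam k / (1 - lam k)) * (lam l / (1 - lam l))
    let DΔ : ι → ι → ℝ := fun k l =>
      (lam k * lam l * cΔ / (1 - lam k * lam l * cΔ)) *
        ((1 - lam k * lam l) / ((1 - lam k) * (1 - lam l)))
    (0 ≤ cΔ ∧ cΔ ≤ 1) ∧
      ∀ y : ι → ℝ,
        ∑ k, ∑ l, C k l * (DΔ k l - C k l) * y k * y l ≤ 0 := by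
  intro cΔ C DΔ
  have hq : 0 < 1 - p := by linarith
  have hc : 0 ≤ cΔ := div_nonneg (by linarith) (by positivity)
  have hc1 : cΔ ≤ 1 := by
    refine (div_le_one (by positivity)).2 ?_
    nlinarith
  refine ⟨⟨hc, hc1⟩, fun y => ?_⟩
  have key := aux_psd cΔ hc hc1 lam (fun k => (lam k / (1 - lam k)) ^ 2 * y k) hlam
  have e : ∑ k, ∑ l, C k l * (DΔ k l - C k l) * y k * y l
      = (cΔ - 1) * ∑ k, ∑ l, (1 - lam k * lam l * cΔ)⁻¹ *
        (((lam k / (1 - lam k)) ^ 2 * y k) * ((lam l / (1 - lam l)) ^ 2 * y l)) := by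
    rw [Finset.mul_sum]
    refine Finset.sum_congr rfl fun k _ => ?_
    rw [Finset.mul_sum]
    refine Finset.sum_congr rfl fun l _ => ?_
    have hk : 1 - lam k ≠ 0 := by have := (abs_lt.1 (hlam k)).2; intro h; linarith
    have hl : 1 - lam l ≠ 0 := by have := (abs_lt.1 (hlam l)).2; intro h; linarith
    have hkl : 1 - lam k * lam l * cΔ ≠ 0 := by
      have h1 : |lam k * lam l| < 1 := by
        rw [abs_mul]
        exact mul_lt_one_of_nonneg_of_lt_one_left (abs_nonneg _) (hlam k) (hlam l).le
      have := (abs_lt.1 h1).2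
      intro h
      have h2 : cΔ = 1 := le_antisymm hc1 (by nlinarith [mul_nonneg hc (sub_nonneg.2 this.le)])
      rw [h2] at h
      linarith
    simp only [C, DΔ]
    clear_value cΔ
    field_simp
    ring
  rw [e]
  exact mul_nonpos_of_nonpos_of_nonneg (by linarith) key
end
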